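/- arXiv:1108.4129 — 3 statements merged into one kernel-verified Lean document; each statement's English description precedes it below -/
import Mathlib

section
/- Let f : (0,∞) → [0,∞] be measurable and ε > 0. Let S = {0} × [−ε/2, ε/2] ⊂ ℝ², let H⁻ = {x ∈ ℝ² : x₁ < 0} and H⁺ = {y ∈ ℝ² : y₁ > 0}. Then ∫_{H⁻} ∫_{H⁺} f(‖y − x‖)·1{the closed segment [x, y] meets S} dy dx = 2ε·∫₀^∞ r²·f(r) dr. -/
open MeasureTheory Set
open scoped ENNReal Classical

/-- The coordinate map from the Euclidean plane to `ℝ × ℝ` preserves Lebesgue measure. -/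
lemma measurePreserving_euclidean_coords :
    MeasurePreserving (fun x : EuclideanSpace ℝ (Fin 2) => (x 0, x 1)) :=
  (volume_preserving_finTwoArrow ℝ).comp (PiLp.volume_preserving_ofLp (Fin 2))

lemma lintegral_lintegral_euclidean_coords {K : (ℝ × ℝ) × (ℝ × ℝ) → ℝ≥0∞} (hK : Measurable K) :
    ∫⁻ x : EuclideanSpace ℝ (Fin 2), ∫⁻ y : EuclideanSpace ℝ (Fin 2),
      K ((x 0, x 1), (y 0, y 1)) = ∫⁻ p, ∫⁻ q, K (p, q) := by
  have hφ := measurePreserving_euclidean_coords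
  rw [← hφ.lintegral_comp hK.lintegral_prod_right']
  exact lintegral_congr fun x => hφ.lintegral_comp (hK.comp measurable_prodMk_left)

/-- A segment crossing the vertical axis from left to right meets `{0} × [-δ, δ]` exactly when
its intercept on that axis lies in `[-δ, δ]`. -/
lemma segment_inter_vertical_nonempty_iff {x y : EuclideanSpace ℝ (Fin 2)} (hx : x 0 < 0)
    (hy : 0 < y 0) (δ : ℝ) :
    (segment ℝ x y ∩ {p : EuclideanSpace ℝ (Fin 2) | p 0 = 0 ∧ p 1 ∈ Icc (-δ) δ}).Nonempty ↔
      x 1 - x 0 * ((y 1 - x 1) / (y 0 - x 0)) ∈ Icc (-δ) δ := by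
  have hd : 0 < y 0 - x 0 := by linarith
  constructor
  · rintro ⟨p, ⟨a, b, ha, hb, hab, rfl⟩, h0, h1⟩
    simp only [PiLp.add_apply, PiLp.smul_apply, smul_eq_mul] at h0 h1
    obtain rfl : a = 1 - b := by linarith
    have hb' : b = -x 0 / (y 0 - x 0) := by
      rw [eq_div_iff hd.ne']; linarith
    convert h1 using 1
    rw [hb']; field_simp; ring
  · intro h
    refine ⟨_, ⟨y 0 / (y 0 - x 0), -x 0 / (y 0 - x 0), by positivity,
      div_nonneg (by linarith) hd.le, by field_simp; ring, rfl⟩, ?_, ?_⟩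
    · simp only [PiLp.add_apply, PiLp.smul_apply, smul_eq_mul]
      field_simp; ring
    · simp only [PiLp.add_apply, PiLp.smul_apply, smul_eq_mul]
      convert h using 1
      field_simp; ring

/-- Area of a sheared rectangle of width `w` and height `2 * δ`. -/
lemma volume_sheared_rectangle (w m δ : ℝ) :
    volume {p : ℝ × ℝ | p.1 < 0 ∧ 0 < p.1 + w ∧ p.2 - p.1 * m ∈ Icc (-δ) δ} =
      ENNReal.ofReal w * ENNReal.ofReal (2 * δ) := by
  have hm : MeasurableSet {p : ℝ × ℝ | p.1 < 0 ∧ 0 < p.1 + w ∧ p.2 - p.1 * m ∈ Icc (-δ) δ} := by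
    simp only [mem_Icc]
    measurability
  rw [Measure.volume_eq_prod, Measure.prod_apply hm]
  have key : ∀ a : ℝ, volume (Prod.mk a ⁻¹'
      {p : ℝ × ℝ | p.1 < 0 ∧ 0 < p.1 + w ∧ p.2 - p.1 * m ∈ Icc (-δ) δ}) =
      (Ioo (-w) 0).indicator (fun _ => ENNReal.ofReal (2 * δ)) a := by
    intro a
    by_cases ha : a ∈ Ioo (-w) 0
    · rw [indicator_of_mem ha]
      have : Prod.mk a ⁻¹' {p : ℝ × ℝ | p.1 < 0 ∧ 0 < p.1 + w ∧ p.2 - p.1 * m ∈ Icc (-δ) δ} =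
          Icc (a * m - δ) (a * m + δ) := by
        ext b
        simp only [mem_preimage, mem_ofPred_eq, mem_Icc, mem_Ioo] at ha ⊢
        constructor
        · rintro ⟨-, -, h1, h2⟩; constructor <;> linarith
        · rintro ⟨h1, h2⟩; refine ⟨?_, ?_, ?_, ?_⟩ <;> linarith
      rw [this, Real.volume_Icc]
      congr 1; ring
    · rw [indicator_of_notMem ha]
      convert measure_empty (μ := (volume : Measure ℝ))
      ext b
      simp only [mem_preimage, mem_ofPred_eq, mem_empty_iff_false, iff_false]
      rintro ⟨h1, h2, -⟩
      exact ha ⟨by linarith, h1⟩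
  simp_rw [key]
  rw [lintegral_indicator measurableSet_Ioo, setLIntegral_const, Real.volume_Ioo, mul_comm]
  simp

lemma lintegral_ofReal_cos : ∫⁻ θ in Ioo (-Real.pi) Real.pi, ENNReal.ofReal (Real.cos θ) = 2 := by
  have hpi := Real.pi_pos
  have hsub : Ioc (-(Real.pi / 2)) (Real.pi / 2) ⊆ Ioo (-Real.pi) Real.pi := fun θ hθ =>
    ⟨by linarith [hθ.1], by linarith [hθ.2]⟩
  have hzero : ∀ θ ∈ Ioo (-Real.pi) Real.pi, ENNReal.ofReal (Real.cos θ) =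
      (Ioc (-(Real.pi / 2)) (Real.pi / 2)).indicator (fun θ => ENNReal.ofReal (Real.cos θ)) θ := by
    rintro θ ⟨h1, h2⟩
    by_cases h3 : θ ∈ Ioc (-(Real.pi / 2)) (Real.pi / 2)
    · rw [indicator_of_mem h3]
    rw [indicator_of_notMem h3, ENNReal.ofReal_eq_zero]
    rw [mem_Ioc, not_and_or, not_lt, not_le] at h3
    rcases h3 with h3 | h3
    · rw [← Real.cos_neg]
      exact Real.cos_nonpos_of_pi_div_two_le_of_le (by linarith) (by linarith)
    · exact Real.cos_nonpos_of_pi_div_two_le_of_le h3.le (by linarith)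
  rw [setLIntegral_congr_fun measurableSet_Ioo hzero, setLIntegral_indicator measurableSet_Ioc,
    inter_eq_left.2 hsub, ← ofReal_integral_eq_lintegral_ofReal,
    ← intervalIntegral.integral_of_le (by linarith), integral_cos]
  · norm_num
  · exact (Real.continuous_cos.integrableOn_Icc).mono_set Ioc_subset_Icc_self
  · refine (ae_restrict_iff' measurableSet_Ioc).2 (.of_forall fun θ hθ => ?_)
    exact Real.cos_nonneg_of_mem_Icc ⟨hθ.1.le, hθ.2⟩

/-- Integral of a radial function against the positive part of the first coordinate. -/
lemma lintegral_radial_mul_ofReal_fst {f : ℝ → ℝ≥0∞} (hf : Measurable f) :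
    ∫⁻ z : ℝ × ℝ, f (√(z.1 ^ 2 + z.2 ^ 2)) * ENNReal.ofReal z.1 =
      2 * ∫⁻ r in Ioi (0 : ℝ), ENNReal.ofReal (r ^ 2) * f r := by
  rw [← lintegral_comp_polarCoord_symm, polarCoord_target, Measure.volume_eq_prod,
    ← Measure.prod_restrict]
  have h : ∀ p ∈ Ioi (0 : ℝ) ×ˢ Ioo (-Real.pi) Real.pi,
      ENNReal.ofReal p.1 • (f (√((polarCoord.symm p).1 ^ 2 + (polarCoord.symm p).2 ^ 2)) *
        ENNReal.ofReal (polarCoord.symm p).1) =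
      (ENNReal.ofReal (p.1 ^ 2) * f p.1) * ENNReal.ofReal (Real.cos p.2) := by
    rintro ⟨r, θ⟩ ⟨hr, -⟩
    have hr : 0 < r := hr
    have hs : √((r * Real.cos θ) ^ 2 + (r * Real.sin θ) ^ 2) = r := by
      rw [show (r * Real.cos θ) ^ 2 + (r * Real.sin θ) ^ 2 = r ^ 2 by
        linear_combination r ^ 2 * Real.sin_sq_add_cos_sq θ, Real.sqrt_sq hr.le]
    simp only [polarCoord_symm_apply, hs, smul_eq_mul]
    rw [ENNReal.ofReal_mul hr.le, pow_two, ENNReal.ofReal_mul hr.le]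
    ring
  rw [Measure.prod_restrict,
    setLIntegral_congr_fun (measurableSet_Ioi.prod measurableSet_Ioo) h, ← Measure.prod_restrict,
    lintegral_prod_mul (f := fun r => ENNReal.ofReal (r ^ 2) * f r)
      (g := fun θ => ENNReal.ofReal (Real.cos θ)) (by fun_prop) (by fun_prop),
    lintegral_ofReal_cos, mul_comm]

/-- The flow integral over pairs of points of `ℝ × ℝ` on either side of the vertical axis. -/
lemma lintegral_lintegral_crossing {f : ℝ → ℝ≥0∞} (hf : Measurable f) (δ : ℝ) :
    ∫⁻ p : ℝ × ℝ, ∫⁻ q : ℝ × ℝ,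
      (if p.1 < 0 ∧ 0 < q.1 ∧ p.2 - p.1 * ((q.2 - p.2) / (q.1 - p.1)) ∈ Icc (-δ) δ
        then f (√((q.1 - p.1) ^ 2 + (q.2 - p.2) ^ 2)) else 0) =
      ENNReal.ofReal (2 * δ) * (2 * ∫⁻ r in Ioi (0 : ℝ), ENNReal.ofReal (r ^ 2) * f r) := by
  have htr : ∀ p : ℝ × ℝ, ∫⁻ q : ℝ × ℝ,
      (if p.1 < 0 ∧ 0 < q.1 ∧ p.2 - p.1 * ((q.2 - p.2) / (q.1 - p.1)) ∈ Icc (-δ) δ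
        then f (√((q.1 - p.1) ^ 2 + (q.2 - p.2) ^ 2)) else 0) =
      ∫⁻ z : ℝ × ℝ, (if p.1 < 0 ∧ 0 < p.1 + z.1 ∧ p.2 - p.1 * (z.2 / z.1) ∈ Icc (-δ) δ
        then f (√(z.1 ^ 2 + z.2 ^ 2)) else 0) := by
    intro p
    rw [← lintegral_add_left_eq_self _ p]
    simp only [Prod.fst_add, Prod.snd_add, add_sub_cancel_left]
  simp_rw [htr]
  rw [lintegral_lintegral_swap]
  · have hz : ∀ z : ℝ × ℝ, ∫⁻ p : ℝ × ℝ,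
        (if p.1 < 0 ∧ 0 < p.1 + z.1 ∧ p.2 - p.1 * (z.2 / z.1) ∈ Icc (-δ) δ
          then f (√(z.1 ^ 2 + z.2 ^ 2)) else 0) =
        ENNReal.ofReal (2 * δ) * (f (√(z.1 ^ 2 + z.2 ^ 2)) * ENNReal.ofReal z.1) := by
      intro z
      have hm : MeasurableSet {p : ℝ × ℝ | p.1 < 0 ∧ 0 < p.1 + z.1 ∧
          p.2 - p.1 * (z.2 / z.1) ∈ Icc (-δ) δ} := by
        simp only [mem_Icc]
        measurability
      have := lintegral_indicator_const (μ := volume) hm (f (√(z.1 ^ 2 + z.2 ^ 2)))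
      simp only [indicator_apply, mem_ofPred_eq] at this
      rw [this, volume_sheared_rectangle]
      ring
    simp_rw [hz]
    rw [lintegral_const_mul _ (by fun_prop), lintegral_radial_mul_ofReal_fst hf]
  · refine (Measurable.ite ?_ (by fun_prop) measurable_const).aemeasurable
    simp only [mem_Icc]
    measurability

/-- Flow of P2P data crossing a vertical segment `S = {0} × [−ε/2, ε/2]` of length `ε`
in the planar fluid model:
`∫_{H⁻} ∫_{H⁺} f(‖y−x‖)·1{[x,y] ∩ S ≠ ∅} dy dx = 2ε·∫₀^∞ r²·f(r) dr`. -/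
theorem stmt_5 (f : ℝ → ℝ≥0∞) (hf : Measurable f) (ε : ℝ) (hε : 0 < ε) :
    (∫⁻ x in {x : EuclideanSpace ℝ (Fin 2) | x 0 < 0},
      ∫⁻ y in {y : EuclideanSpace ℝ (Fin 2) | 0 < y 0},
        (if (segment ℝ x y ∩
              {p : EuclideanSpace ℝ (Fin 2) | p 0 = 0 ∧ p 1 ∈ Icc (-(ε/2)) (ε/2)}).Nonempty
          then f ‖y - x‖ else 0)) =
      ENNReal.ofReal (2 * ε) * ∫⁻ r in Ioi (0:ℝ), ENNReal.ofReal (r ^ 2) * f r := by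
  have hmx : MeasurableSet {x : EuclideanSpace ℝ (Fin 2) | x 0 < 0} :=
    measurableSet_lt (by fun_prop) measurable_const
  have hmy : MeasurableSet {y : EuclideanSpace ℝ (Fin 2) | 0 < y 0} :=
    measurableSet_lt measurable_const (by fun_prop)
  have hK : Measurable (fun pq : (ℝ × ℝ) × (ℝ × ℝ) =>
      if pq.1.1 < 0 ∧ 0 < pq.2.1 ∧
          pq.1.2 - pq.1.1 * ((pq.2.2 - pq.1.2) / (pq.2.1 - pq.1.1)) ∈ Icc (-(ε/2)) (ε/2)
        then f (√((pq.2.1 - pq.1.1) ^ 2 + (pq.2.2 - pq.1.2) ^ 2)) else 0) := by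
    refine Measurable.ite ?_ (by fun_prop) measurable_const
    simp only [mem_Icc]
    measurability
  have hmain := (lintegral_lintegral_euclidean_coords hK).trans
    (lintegral_lintegral_crossing hf (ε / 2))
  rw [show ENNReal.ofReal (2 * ε) = ENNReal.ofReal (2 * (ε / 2)) * 2 by
    rw [ENNReal.ofReal_mul zero_le_two, mul_div_cancel₀ _ two_ne_zero, mul_comm]; simp,
    mul_assoc, ← hmain, ← lintegral_indicator hmx]
  refine lintegral_congr fun x => ?_
  by_cases hx : x 0 < 0
  · rw [indicator_of_mem (show x ∈ {x : EuclideanSpace ℝ (Fin 2) | x 0 < 0} from hx),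
      ← lintegral_indicator hmy]
    refine lintegral_congr fun y => ?_
    by_cases hy : 0 < y 0
    · rw [indicator_of_mem (show y ∈ {y : EuclideanSpace ℝ (Fin 2) | 0 < y 0} from hy)]
      simp only [segment_inter_vertical_nonempty_iff hx hy, hx, hy, true_and]
      simp [EuclideanSpace.norm_eq, Fin.sum_univ_two]
    · rw [indicator_of_notMem (show y ∉ {y : EuclideanSpace ℝ (Fin 2) | 0 < y 0} from hy)]
      simp [hy]
  · rw [indicator_of_notMem (show x ∉ {x : EuclideanSpace ℝ (Fin 2) | x 0 < 0} from hx)]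
    simp [hx]
end

section
/- For every real N > 0, there exists a unique real M ≥ 1 satisfying M²·(1 − (M/(2N))·ln(1 + 2N/M)) = 1. -/
open Set in
theorem log_one_add_lt_of_pos {t : ℝ} (ht : 0 < t) :
    Real.log (1 + t) < t * (3 + 2 * t) / (3 * (1 + t)) := by
  have hderiv : ∀ x : ℝ, 0 ≤ x →
      HasDerivAt (fun x : ℝ => x * (3 + 2 * x) / (3 * (1 + x)) - Real.log (1 + x))
        (x * (1 + 2 * x) / (3 * (1 + x) ^ 2)) x := by
    intro x hx
    have h1 : (1 + x) ≠ 0 := by positivity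
    have hid := hasDerivAt_id' x
    have hlin : HasDerivAt (fun x : ℝ => 1 + x) 1 x := hid.const_add 1
    have h := ((hid.mul ((hid.const_mul 2).const_add 3)).div (hlin.const_mul 3)
      (by positivity)).sub (hlin.log h1)
    refine h.congr_deriv ?_
    simp only [Pi.mul_apply]
    field_simp
    ring
  have hmono : StrictMonoOn
      (fun x : ℝ => x * (3 + 2 * x) / (3 * (1 + x)) - Real.log (1 + x)) (Ici 0) := by
    refine strictMonoOn_of_deriv_pos (convex_Ici 0)
      (fun x hx => (hderiv x hx).continuousAt.continuousWithinAt) ?_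
    intro x hx
    rw [interior_Ici, mem_Ioi] at hx
    rw [(hderiv x hx.le).deriv]
    positivity
  have h := hmono self_mem_Ici ht.le ht
  simp only [zero_mul, zero_div, add_zero, Real.log_one, sub_zero] at h
  linarith

theorem hasDerivAt_sq_mul_one_sub_log {N x : ℝ} (hN : 0 < N) (hx : 0 < x) :
    HasDerivAt (fun M : ℝ => M ^ 2 * (1 - (M / (2 * N)) * Real.log (1 + 2 * N / M)))
      (3 * x ^ 2 / (2 * N) * (2 * N / x * (3 + 2 * (2 * N / x)) / (3 * (1 + 2 * N / x))
        - Real.log (1 + 2 * N / x))) x := by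
  have hid := hasDerivAt_id' x
  have h1 : 1 + 2 * N / x ≠ 0 := by positivity
  have hlog := (((hasDerivAt_const x (2 * N)).div hid hx.ne').const_add 1).log h1
  have h := (hid.pow 2).mul (((hid.div_const (2 * N)).mul hlog).const_sub 1)
  refine h.congr_deriv ?_
  simp only [Pi.mul_apply, Pi.div_apply, Pi.pow_apply]
  have h2 : x + 2 * N ≠ 0 := by positivity
  generalize Real.log (1 + 2 * N / x) = L
  field_simp
  ring

open Set in
/-- TCP heuristic fixed point: for every `N > 0` there is a unique `M ≥ 1` with
`M²·(1 − (M/(2N))·ln(1 + 2N/M)) = 1`. -/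
theorem stmt_11 (N : ℝ) (hN : 0 < N) :
    ∃! M : ℝ, 1 ≤ M ∧
      M ^ 2 * (1 - (M / (2 * N)) * Real.log (1 + 2 * N / M)) = 1 := by
  set F : ℝ → ℝ := fun M => M ^ 2 * (1 - (M / (2 * N)) * Real.log (1 + 2 * N / M)) with hF
  have hcont : ContinuousOn F (Ici 1) := fun x hx =>
    (hasDerivAt_sq_mul_one_sub_log hN
      (lt_of_lt_of_le one_pos hx)).continuousAt.continuousWithinAt
  have hmono : StrictMonoOn F (Ici 1) := by
    refine strictMonoOn_of_deriv_pos (convex_Ici 1) hcont ?_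
    intro x hx
    rw [interior_Ici, mem_Ioi] at hx
    have hx0 : 0 < x := one_pos.trans hx
    rw [(hasDerivAt_sq_mul_one_sub_log hN hx0).deriv]
    exact mul_pos (by positivity) (sub_pos.2 (log_one_add_lt_of_pos (by positivity)))
  have hone : F 1 ≤ 1 := by
    have h : 0 ≤ 1 / (2 * N) * Real.log (1 + 2 * N / 1) :=
      mul_nonneg (by positivity) (Real.log_nonneg (by linarith))
    simp only [hF]
    linarith
  have hle : (1 : ℝ) ≤ 3 + 2 / N := by
    have : 0 < 2 / N := by positivity
    linarith
  have hlarge : 1 ≤ F (3 + 2 / N) := by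
    generalize hM : 3 + 2 / N = M at hle ⊢
    have hM0 : 0 < M := by linarith
    have hNM : N * M = 3 * N + 2 := by rw [← hM]; field_simp
    have hlog := log_one_add_lt_of_pos (t := 2 * N / M) (by positivity)
    calc (1 : ℝ) ≤ 2 * N * M ^ 2 / (3 * (M + 2 * N)) := by
          rw [le_div_iff₀ (by positivity)]
          nlinarith
      _ = M ^ 2 * (1 - M / (2 * N) *
          (2 * N / M * (3 + 2 * (2 * N / M)) / (3 * (1 + 2 * N / M)))) := by
          field_simp
          ring
      _ ≤ F M := by
          simp only [hF]
          gcongr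
  obtain ⟨M, hM, hFM⟩ := intermediate_value_Icc hle
    (hcont.mono Icc_subset_Ici_self) ⟨hone, hlarge⟩
  exact ⟨M, ⟨hM.1, hFM⟩, fun y hy => hmono.injOn hy.1 hM.1 (hy.2.trans hFM.symm)⟩
end

section
/- For N > 0, let M̂(N) denote the unique M ≥ 1 satisfying M²·(1 − (M/(2N))·ln(1 + 2N/M)) = 1. Then M̂(N) → 1 as N → ∞, and N·M̂(N) → 1 as N → 0⁺. -/
open Filter

theorem Real.log_one_add_le_two_mul_sqrt {x : ℝ} (hx : 0 ≤ x) :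
    Real.log (1 + x) ≤ 2 * √x := by
  have hs := Real.sqrt_nonneg x
  calc Real.log (1 + x) ≤ Real.log ((1 + √x) ^ 2) :=
        Real.log_le_log (by linarith) (by nlinarith [Real.sq_sqrt hx])
    _ = 2 * Real.log (1 + √x) := by rw [Real.log_pow]; norm_num
    _ ≤ 2 * √x := by linarith [Real.log_le_sub_one_of_pos (show 0 < 1 + √x by linarith)]

theorem Real.log_one_add_le_div {x : ℝ} (hx : 0 ≤ x) :
    Real.log (1 + x) ≤ x * (x + 2) / (2 * (1 + x)) := by
  have h := Real.self_le_sinh_iff.2 (Real.log_nonneg (show 1 ≤ 1 + x by linarith))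
  rw [Real.sinh_log (by linarith)] at h
  convert h using 1
  field_simp
  ring

/-- A solution of the heuristic equation satisfies `1 ≤ N * M`. -/
theorem one_le_mul_of_heuristic {N M : ℝ} (hN : 0 < N) (hM : 0 < M)
    (h : M ^ 2 * (1 - (M / (2 * N)) * Real.log (1 + 2 * N / M)) = 1) : 1 ≤ N * M := by
  have hlog := Real.le_log_one_add_of_nonneg (show 0 ≤ 2 * N / M by positivity)
  have hfac : 1 - M / (2 * N) * Real.log (1 + 2 * N / M) ≤ N / (N + M) := by
    have := mul_le_mul_of_nonneg_left hlog (show 0 ≤ M / (2 * N) by positivity)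
    have e : M / (2 * N) * (2 * (2 * N / M) / (2 * N / M + 2)) = 1 - N / (N + M) := by
      field_simp
      ring
    linarith
  have h1 : 1 ≤ M ^ 2 * (N / (N + M)) := h ▸ mul_le_mul_of_nonneg_left hfac (sq_nonneg M)
  rw [← mul_div_assoc, le_div_iff₀ (by positivity)] at h1
  nlinarith

/-- A solution of the heuristic equation satisfies `N * M ^ 2 ≤ M + 2 * N`. -/
theorem mul_sq_le_of_heuristic {N M : ℝ} (hN : 0 < N) (hM : 0 < M)
    (h : M ^ 2 * (1 - (M / (2 * N)) * Real.log (1 + 2 * N / M)) = 1) :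
    N * M ^ 2 ≤ M + 2 * N := by
  have hlog := Real.log_one_add_le_div (show 0 ≤ 2 * N / M by positivity)
  have hfac : N / (M + 2 * N) ≤ 1 - M / (2 * N) * Real.log (1 + 2 * N / M) := by
    have := mul_le_mul_of_nonneg_left hlog (show 0 ≤ M / (2 * N) by positivity)
    have e : M / (2 * N) * (2 * N / M * (2 * N / M + 2) / (2 * (1 + 2 * N / M)))
        = 1 - N / (M + 2 * N) := by
      field_simp
      ring
    linarith
  have h1 : M ^ 2 * (N / (M + 2 * N)) ≤ 1 := h ▸ mul_le_mul_of_nonneg_left hfac (sq_nonneg M)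
  rw [← mul_div_assoc, div_le_one (by positivity)] at h1
  linarith

/-- For `1 ≤ N`, a solution `M ≥ 1` of the heuristic equation is within `8 / √N` of `1`. -/
theorem le_one_add_div_sqrt_of_heuristic {N M : ℝ} (hN : 1 ≤ N) (hM : 1 ≤ M)
    (h : M ^ 2 * (1 - (M / (2 * N)) * Real.log (1 + 2 * N / M)) = 1) :
    M ≤ 1 + 8 / √N := by
  have hM2 : M ≤ 2 := by
    nlinarith [mul_sq_le_of_heuristic (by linarith) (by linarith) h,
      mul_nonneg (sub_nonneg.2 hN) (sub_nonneg.2 hM)]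
  have hx : N ≤ 2 * N / M := by
    rw [le_div_iff₀ (by linarith)]
    nlinarith
  set x := 2 * N / M with hxdef
  have hx0 : 0 < x := by linarith
  have hratio : M / (2 * N) * Real.log (1 + x) ≤ 2 / √N := by
    have e : M / (2 * N) = 1 / x := by rw [hxdef, one_div_div]
    rw [e]
    calc 1 / x * Real.log (1 + x) ≤ 1 / x * (2 * √x) :=
          mul_le_mul_of_nonneg_left (Real.log_one_add_le_two_mul_sqrt hx0.le) (by positivity)
      _ = 2 / √x := by
          have hs := Real.sqrt_pos.2 hx0
          field_simp
          rw [Real.sq_sqrt hx0.le]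
      _ ≤ 2 / √N := by gcongr
  have hprod : M ^ 2 * (M / (2 * N) * Real.log (1 + x)) ≤ 4 * (2 / √N) :=
    mul_le_mul (by nlinarith) hratio
      (mul_nonneg (by positivity) (Real.log_nonneg (by linarith))) (by norm_num)
  have e : 4 * (2 / √N) = 8 / √N := by ring
  nlinarith

/-- Asymptotics of the TCP heuristic `M̂`: if `M̂(N)` is for each `N > 0` the (unique)
solution in `[1,∞)` of `M²(1 − (M/(2N))·ln(1 + 2N/M)) = 1`, then `M̂(N) → 1` as
`N → ∞` and `N·M̂(N) → 1` as `N → 0⁺`. -/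
theorem stmt_12 (Mhat : ℝ → ℝ)
    (h : ∀ N : ℝ, 0 < N → 1 ≤ Mhat N ∧
      (Mhat N) ^ 2 * (1 - (Mhat N / (2 * N)) * Real.log (1 + 2 * N / Mhat N)) = 1) :
    Tendsto Mhat atTop (nhds 1) ∧
    Tendsto (fun N => N * Mhat N) (nhdsWithin 0 (Set.Ioi 0)) (nhds 1) := by
  constructor
  · have hlim : Tendsto (fun N : ℝ => 1 + 8 / √N) atTop (nhds 1) := by
      simpa using (Real.tendsto_sqrt_atTop.const_div_atTop 8).const_add 1
    refine tendsto_of_tendsto_of_tendsto_of_le_of_le' tendsto_const_nhds hlim ?_ ?_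
    · filter_upwards [eventually_gt_atTop 0] with N hN using (h N hN).1
    · filter_upwards [eventually_ge_atTop 1] with N hN
      have hN0 : 0 < N := by linarith
      exact le_one_add_div_sqrt_of_heuristic hN (h N hN0).1 (h N hN0).2
  · have hlim : Tendsto (fun N : ℝ => 1 + 2 * N ^ 2) (nhdsWithin 0 (Set.Ioi 0)) (nhds 1) := by
      have hc : Continuous fun N : ℝ => 1 + 2 * N ^ 2 := by fun_prop
      simpa using (hc.tendsto 0).mono_left nhdsWithin_le_nhds
    refine tendsto_of_tendsto_of_tendsto_of_le_of_le' tendsto_const_nhds hlim ?_ ?_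
    · filter_upwards [self_mem_nhdsWithin] with N (hN : 0 < N)
      exact one_le_mul_of_heuristic hN (by linarith [(h N hN).1]) (h N hN).2
    · filter_upwards [self_mem_nhdsWithin] with N (hN : 0 < N)
      have hM : 0 < Mhat N := by linarith [(h N hN).1]
      have h1 := one_le_mul_of_heuristic hN hM (h N hN).2
      have h2 := mul_le_mul_of_nonneg_left (mul_sq_le_of_heuristic hN hM (h N hN).2) hN.le
      nlinarith [mul_nonneg (sub_nonneg.2 h1) (sub_nonneg.2 h1)]
end
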